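/- Let d ≥ 1, σ > 0, λ ∈ ℝ, and let r ≥ 0 be an integer. Define a₀ : ℝ^d → ℝ by a₀(y) = exp(−‖y‖²), and for κ ∈ (0,1], ε > 0, τ ≥ 0 define φ_τ : ℝ^d → ℂ by φ_τ(y) = κ·a₀(y)·exp(−i·λ·(τ/ε)·κ^{2σ}·a₀(y)^{2σ}). Then there exists a constant C > 0, depending only on d, σ, λ, r, such that for all κ ∈ (0,1], ε > 0, τ ≥ 0: (∫_{ℝ^d} ‖D^r φ_τ(y)‖² dy)^{1/2} ≤ C·(κ^{1+2σr}·(τ/ε)^r + κ), where D^r φ_τ(y) denotes the r-th iterated Fréchet derivative of φ_τ at y and ‖·‖ its operator norm. -/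

import Mathlib

open MeasureTheory

section IteratedDerivativeBounds

variable {E : Type*} [NormedAddCommGroup E] [InnerProductSpace ℝ E]

lemma norm_iteratedFDeriv_fun_id_le (n : ℕ) (x : E) :
    ‖iteratedFDeriv ℝ n (fun y : E => y) x‖ ≤ if n = 0 then ‖x‖ else 1 := by
  rcases n with _ | n
  · simp
  rw [if_neg n.succ_ne_zero, ← norm_iteratedFDeriv_fderiv]
  have h : fderiv ℝ (fun y : E => y) = fun _ => ContinuousLinearMap.id ℝ E := by
    ext1 y
    exact fderiv_fun_id
  rw [h]
  rcases n with _ | n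
  · simpa using ContinuousLinearMap.norm_id_le
  · simp [iteratedFDeriv_const_of_ne n.succ_ne_zero]

lemma norm_iteratedFDeriv_norm_sq_le {n : ℕ} (hn : 1 ≤ n) (x : E) :
    ‖iteratedFDeriv ℝ n (fun y : E => ‖y‖ ^ 2) x‖ ≤ (2 * (1 + ‖x‖)) ^ n := by
  have h : (fun y : E => ‖y‖ ^ 2) = fun y => innerSL ℝ y y := by
    ext y
    simp
  rw [h]
  refine ((innerSL ℝ).norm_iteratedFDeriv_le_of_bilinear_of_le_one (N := n) contDiff_id
    contDiff_id x le_rfl (norm_innerSL_le ℝ)).trans ?_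
  have hx := norm_nonneg x
  have hle : 1 + ‖x‖ ≤ (1 + ‖x‖) ^ n := le_self_pow₀ (by linarith) (by omega)
  calc _ ≤ ∑ i ∈ Finset.range (n + 1), (n.choose i : ℝ) * (1 + ‖x‖) ^ n := by
        refine Finset.sum_le_sum fun i hi => ?_
        rw [mul_assoc]
        refine mul_le_mul_of_nonneg_left ?_ (by positivity)
        refine (mul_le_mul (norm_iteratedFDeriv_fun_id_le i x)
          (norm_iteratedFDeriv_fun_id_le (n - i) x) (norm_nonneg _)
          (by split_ifs <;> positivity)).trans (le_trans ?_ hle)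
        split_ifs <;> first | omega | linarith
    _ = (2 * (1 + ‖x‖)) ^ n := by
        rw [← Finset.sum_mul, mul_pow]
        congr 1
        exact_mod_cast Nat.sum_range_choose n

lemma norm_iteratedFDeriv_exp_neg_mul_norm_sq_le {a : ℝ} (ha : 0 ≤ a) (n : ℕ) (x : E) :
    ‖iteratedFDeriv ℝ n (fun y : E => Real.exp (-a * ‖y‖ ^ 2)) x‖ ≤
      n.factorial * Real.exp (-a * ‖x‖ ^ 2) * ((1 + a) * (2 * (1 + ‖x‖))) ^ n := by
  refine norm_iteratedFDeriv_comp_le (N := n) (g := Real.exp) (f := fun y : E => -a * ‖y‖ ^ 2)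
    Real.contDiff_exp (contDiff_const.mul (contDiff_norm_sq ℝ)) le_rfl x (fun i _ => ?_)
    (fun i hi _ => ?_)
  · rw [norm_iteratedFDeriv_eq_norm_iteratedDeriv, iteratedDeriv_eq_iterate, Real.iter_deriv_exp,
      Real.norm_eq_abs, Real.abs_exp]
  · have h : (fun y : E => -a * ‖y‖ ^ 2) = fun y => (-a) • (fun y : E => ‖y‖ ^ 2) y := rfl
    rw [h, iteratedFDeriv_const_smul_apply' (contDiff_norm_sq ℝ).contDiffAt, norm_smul, mul_pow,
      norm_neg, Real.norm_of_nonneg ha]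
    refine mul_le_mul ?_ (norm_iteratedFDeriv_norm_sq_le hi x) (norm_nonneg _) (by positivity)
    exact (by linarith : a ≤ 1 + a).trans (le_self_pow₀ (by linarith) (by omega))

lemma iteratedDeriv_cexp_ofReal_mul (n : ℕ) (c : ℂ) :
    iteratedDeriv n (fun t : ℝ => Complex.exp (t * c)) =
      fun t : ℝ => c ^ n * Complex.exp (t * c) := by
  induction n with
  | zero => simp
  | succ n ih =>
    rw [iteratedDeriv_succ, ih]
    ext t
    have h : HasDerivAt (fun t : ℝ => (t : ℂ) * c) c t := by
      simpa using (Complex.ofRealCLM.hasDerivAt (x := t)).mul_const c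
    rw [(h.cexp.const_mul (c ^ n)).deriv]
    ring

lemma norm_iteratedFDeriv_cexp_gaussian_phase_le {a : ℝ} (ha : 0 ≤ a) (s : ℝ) (n : ℕ) (x : E) :
    ‖iteratedFDeriv ℝ n
        (fun y : E => Complex.exp (((s * Real.exp (-a * ‖y‖ ^ 2) : ℝ) : ℂ) * (-Complex.I))) x‖ ≤
      n.factorial * ((1 + |s|) * n.factorial * ((1 + a) * (2 * (1 + ‖x‖)))) ^ n := by
  have hgauss : ContDiff ℝ n (fun y : E => Real.exp (-a * ‖y‖ ^ 2)) :=
    (contDiff_const.mul (contDiff_norm_sq ℝ)).exp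
  have hexp : ContDiff ℝ n (fun t : ℝ => Complex.exp (t * (-Complex.I))) :=
    (Complex.ofRealCLM.contDiff.mul contDiff_const).cexp
  have key := norm_iteratedFDeriv_comp_le (C := 1)
    (D := (1 + |s|) * n.factorial * ((1 + a) * (2 * (1 + ‖x‖))))
    hexp (contDiff_const.mul hgauss : ContDiff ℝ n (fun y : E => s * Real.exp (-a * ‖y‖ ^ 2)))
    le_rfl x (fun i _ => ?_) (fun i hi hin => ?_)
  · simpa [Function.comp_def] using key
  · rw [norm_iteratedFDeriv_eq_norm_iteratedDeriv, iteratedDeriv_cexp_ofReal_mul]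
    generalize s * Real.exp (-a * ‖x‖ ^ 2) = t
    simp [Complex.norm_exp]
  · have h : (fun y : E => s * Real.exp (-a * ‖y‖ ^ 2)) =
        fun y => s • (fun y : E => Real.exp (-a * ‖y‖ ^ 2)) y := rfl
    rw [h, iteratedFDeriv_const_smul_apply' (hgauss.of_le (by exact_mod_cast hin)).contDiffAt,
      norm_smul, mul_pow, mul_pow, Real.norm_eq_abs, mul_assoc]
    have hfac : (1 : ℝ) ≤ n.factorial := by exact_mod_cast n.factorial_pos
    have hs : |s| ≤ (1 + |s|) ^ i :=
      (by linarith : |s| ≤ 1 + |s|).trans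
        (le_self_pow₀ (by linarith [abs_nonneg s]) (by omega))
    have hif : (i.factorial : ℝ) ≤ (n.factorial : ℝ) ^ i :=
      (by exact_mod_cast Nat.factorial_le hin : (i.factorial : ℝ) ≤ n.factorial).trans
        (le_self_pow₀ hfac (by omega))
    have hexp1 : Real.exp (-a * ‖x‖ ^ 2) ≤ 1 := by
      rw [Real.exp_le_one_iff]
      nlinarith [mul_nonneg ha (sq_nonneg ‖x‖)]
    refine mul_le_mul hs ((norm_iteratedFDeriv_exp_neg_mul_norm_sq_le ha i x).trans ?_)
      (norm_nonneg _) (by positivity)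
    refine mul_le_mul_of_nonneg_right ?_ (by positivity)
    exact (mul_le_of_le_one_right (by positivity) hexp1).trans hif

lemma one_add_pow_mul_exp_neg_sq_le (n : ℕ) {x : ℝ} (hx : 0 ≤ x) :
    (1 + x) ^ n * Real.exp (-x ^ 2) ≤ n.factorial * Real.exp 2 * Real.exp (-(1 / 2) * x ^ 2) := by
  have h := Real.pow_div_factorial_le_exp (1 + x) (by linarith) n
  rw [div_le_iff₀ (by positivity)] at h
  calc _ ≤ Real.exp (1 + x) * n.factorial * Real.exp (-x ^ 2) := by gcongr
    _ = n.factorial * Real.exp (1 + x + -x ^ 2) := by rw [Real.exp_add _ (-x ^ 2)]; ring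
    _ ≤ n.factorial * Real.exp (2 + -(1 / 2) * x ^ 2) := by
        refine mul_le_mul_of_nonneg_left (Real.exp_le_exp.mpr ?_) (by positivity)
        nlinarith [sq_nonneg (x - 1)]
    _ = _ := by rw [Real.exp_add]; ring

lemma exists_norm_iteratedFDeriv_gaussian_smul_phase_le {a : ℝ} (ha : 0 ≤ a) (n : ℕ) :
    ∃ A > (0 : ℝ), ∀ (s : ℝ) (x : E),
      ‖iteratedFDeriv ℝ n (fun y : E => Real.exp (-1 * ‖y‖ ^ 2) •
        Complex.exp (((s * Real.exp (-a * ‖y‖ ^ 2) : ℝ) : ℂ) * (-Complex.I))) x‖ ≤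
      A * (1 + |s|) ^ n * Real.exp (-(1 / 2) * ‖x‖ ^ 2) := by
  set F : ℝ := (n.factorial : ℝ) with hF
  have hF1 : 1 ≤ F := by rw [hF]; exact_mod_cast n.factorial_pos
  set M : ℝ := F * (4 * (1 + a)) with hM
  refine ⟨2 ^ n * F * F * M ^ n * (F * Real.exp 2), by positivity, fun s x => ?_⟩
  have hgauss (b : ℝ) : ContDiff ℝ n (fun y : E => Real.exp (-b * ‖y‖ ^ 2)) :=
    (contDiff_const.mul (contDiff_norm_sq ℝ)).exp
  have hphase : ContDiff ℝ n (fun y : E =>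
      Complex.exp (((s * Real.exp (-a * ‖y‖ ^ 2) : ℝ) : ℂ) * (-Complex.I))) :=
    ((Complex.ofRealCLM.contDiff.comp (contDiff_const.mul (hgauss a))).mul contDiff_const).cexp
  refine (norm_iteratedFDeriv_smul_le (hgauss 1) hphase x le_rfl).trans ?_
  set X := 1 + ‖x‖ with hX
  set S := 1 + |s| with hS
  have hX1 : 1 ≤ X := by linarith [norm_nonneg x]
  have hS1 : 1 ≤ S := by linarith [abs_nonneg s]
  have hterm (i : ℕ) (hi : i ≤ n) :
      ‖iteratedFDeriv ℝ i (fun y : E => Real.exp (-1 * ‖y‖ ^ 2)) x‖ *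
        ‖iteratedFDeriv ℝ (n - i) (fun y : E =>
          Complex.exp (((s * Real.exp (-a * ‖y‖ ^ 2) : ℝ) : ℂ) * (-Complex.I))) x‖ ≤
      F * F * M ^ n * S ^ n * (X ^ n * Real.exp (-‖x‖ ^ 2)) := by
    have hfac (j : ℕ) (hj : j ≤ n) : (j.factorial : ℝ) ≤ F := by
      rw [hF]; exact_mod_cast Nat.factorial_le hj
    have h1 : ‖iteratedFDeriv ℝ i (fun y : E => Real.exp (-1 * ‖y‖ ^ 2)) x‖ ≤
        F * Real.exp (-‖x‖ ^ 2) * (S * (M * X)) ^ i := by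
      refine (norm_iteratedFDeriv_exp_neg_mul_norm_sq_le zero_le_one i x).trans ?_
      rw [neg_one_mul]
      have hbase : (1 + 1) * (2 * X) ≤ S * (M * X) := by
        have hM4 : 4 ≤ M := by rw [hM]; nlinarith
        have : 4 * X ≤ M * X := by gcongr
        have : M * X ≤ S * (M * X) := le_mul_of_one_le_left (by positivity) hS1
        linarith
      exact mul_le_mul (mul_le_mul_of_nonneg_right (hfac i hi) (by positivity))
        (pow_le_pow_left₀ (by positivity) hbase i) (by positivity) (by positivity)
    have h2 := norm_iteratedFDeriv_cexp_gaussian_phase_le ha s (n - i) x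
    have h3 : ((n - i).factorial : ℝ) * (S * (n - i).factorial * ((1 + a) * (2 * X))) ^ (n - i) ≤
        F * (S * (M * X)) ^ (n - i) := by
      have hni := hfac (n - i) (Nat.sub_le n i)
      refine mul_le_mul hni (pow_le_pow_left₀ (by positivity) ?_ _) (by positivity)
        (by positivity)
      calc S * (n - i).factorial * ((1 + a) * (2 * X))
          ≤ S * F * ((1 + a) * (4 * X)) := by gcongr; norm_num
        _ = S * (M * X) := by rw [hM]; ring
    refine (mul_le_mul h1 (h2.trans h3) (norm_nonneg _) (by positivity)).trans_eq ?_
    have hpow : (S * (M * X)) ^ i * (S * (M * X)) ^ (n - i) = S ^ n * (M ^ n * X ^ n) := by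
      rw [← pow_add, Nat.add_sub_cancel' hi, mul_pow, mul_pow]
    linear_combination (F * F * Real.exp (-‖x‖ ^ 2)) * hpow
  calc _ ≤ ∑ i ∈ Finset.range (n + 1),
        (n.choose i : ℝ) * (F * F * M ^ n * S ^ n * (X ^ n * Real.exp (-‖x‖ ^ 2))) := by
        refine Finset.sum_le_sum fun i hi => ?_
        rw [mul_assoc]
        exact mul_le_mul_of_nonneg_left (hterm i (Finset.mem_range_succ_iff.mp hi))
          (by positivity)
    _ = 2 ^ n * (F * F * M ^ n * S ^ n) * (X ^ n * Real.exp (-‖x‖ ^ 2)) := by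
        rw [← Finset.sum_mul, mul_assoc (2 ^ n)]
        congr 1
        exact_mod_cast Nat.sum_range_choose n
    _ ≤ 2 ^ n * (F * F * M ^ n * S ^ n) *
        (F * Real.exp 2 * Real.exp (-(1 / 2) * ‖x‖ ^ 2)) := by
        refine mul_le_mul_of_nonneg_left ?_ (by positivity)
        exact one_add_pow_mul_exp_neg_sq_le n (norm_nonneg x)
    _ = _ := by ring

end IteratedDerivativeBounds

lemma sqrt_integral_sq_le_of_le_gaussian {V : Type*} [NormedAddCommGroup V]
    [InnerProductSpace ℝ V] [FiniteDimensional ℝ V] [MeasurableSpace V] [BorelSpace V]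
    {f : V → ℝ} {K : ℝ} (hK : 0 ≤ K) (hf0 : ∀ x, 0 ≤ f x)
    (hf : ∀ x, f x ≤ K * Real.exp (-(1 / 2) * ‖x‖ ^ 2)) :
    √(∫ x, f x ^ 2) ≤ K * √(∫ x : V, Real.exp (-1 * ‖x‖ ^ 2)) := by
  have hint : Integrable (fun x : V => Real.exp (-1 * ‖x‖ ^ 2)) := by
    refine .of_integral_ne_zero ?_
    have h := GaussianFourier.integral_rexp_neg_mul_sq_norm (V := V) one_pos
    rw [h]
    positivity
  rw [← Real.sqrt_sq hK, ← Real.sqrt_mul (sq_nonneg K), ← integral_const_mul]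
  refine Real.sqrt_le_sqrt (integral_mono_of_nonneg (.of_forall fun x => sq_nonneg _)
    (hint.const_mul _) (.of_forall fun x => ?_))
  refine (pow_le_pow_left₀ (hf0 x) (hf x) 2).trans_eq ?_
  rw [mul_pow, ← Real.exp_nat_mul]
  ring_nf

theorem gaussian_ode_solution_upper_bound (d : ℕ) (hd : 1 ≤ d) (σ lam : ℝ)
    (hσ : 0 < σ) (r : ℕ) :
    ∃ C > (0 : ℝ), ∀ κ ∈ Set.Ioc (0 : ℝ) 1, ∀ ε > (0 : ℝ), ∀ τ ≥ (0 : ℝ),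
      Real.sqrt (∫ y : EuclideanSpace ℝ (Fin d),
        ‖iteratedFDeriv ℝ r (fun z : EuclideanSpace ℝ (Fin d) =>
          ((κ * Real.exp (-‖z‖ ^ 2) : ℝ) : ℂ) *
            Complex.exp (-Complex.I * (lam : ℂ) * ((τ / ε : ℝ) : ℂ)
              * ((κ ^ (2 * σ) * Real.exp (-‖z‖ ^ 2) ^ (2 * σ) : ℝ) : ℂ))) y‖ ^ 2)
      ≤ C * (κ ^ (1 + 2 * σ * (r : ℝ)) * (τ / ε) ^ r + κ) := by
  obtain ⟨A, hA, hbound⟩ := exists_norm_iteratedFDeriv_gaussian_smul_phase_le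
    (E := EuclideanSpace ℝ (Fin d)) (by positivity : 0 ≤ 2 * σ) r
  set J : ℝ := √(∫ x : EuclideanSpace ℝ (Fin d), Real.exp (-1 * ‖x‖ ^ 2)) with hJ
  have hJ0 : 0 ≤ J := Real.sqrt_nonneg _
  refine ⟨A * (2 ^ r * (1 + |lam|) ^ r) * (J + 1), by positivity, fun κ hκ ε hε τ hτ => ?_⟩
  obtain ⟨hκ0, -⟩ := hκ
  set T : ℝ := τ / ε with hT
  have hT0 : 0 ≤ T := by positivity
  set s : ℝ := lam * T * κ ^ (2 * σ) with hs
  set g : EuclideanSpace ℝ (Fin d) → ℂ := fun y => Real.exp (-1 * ‖y‖ ^ 2) •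
    Complex.exp (((s * Real.exp (-(2 * σ) * ‖y‖ ^ 2) : ℝ) : ℂ) * (-Complex.I)) with hg
  have hfun : (fun z : EuclideanSpace ℝ (Fin d) =>
      ((κ * Real.exp (-‖z‖ ^ 2) : ℝ) : ℂ) *
        Complex.exp (-Complex.I * (lam : ℂ) * (T : ℂ)
          * ((κ ^ (2 * σ) * Real.exp (-‖z‖ ^ 2) ^ (2 * σ) : ℝ) : ℂ))) = fun z => κ • g z := by
    ext z
    rw [hg, ← Real.exp_mul, hs]
    simp only [Complex.real_smul]
    rw [Complex.ofReal_mul, mul_assoc, neg_one_mul,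
      show -‖z‖ ^ 2 * (2 * σ) = -(2 * σ) * ‖z‖ ^ 2 by ring]
    congr 3
    push_cast
    ring
  have hgd : ContDiff ℝ r g := by
    have hgauss (b : ℝ) :
        ContDiff ℝ r (fun y : EuclideanSpace ℝ (Fin d) => Real.exp (-b * ‖y‖ ^ 2)) :=
      (contDiff_const.mul (contDiff_norm_sq ℝ)).exp
    exact (hgauss 1).smul ((Complex.ofRealCLM.contDiff.comp
      (contDiff_const.mul (hgauss (2 * σ)))).mul contDiff_const).cexp
  rw [hfun]
  have hmain := sqrt_integral_sq_le_of_le_gaussian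
    (f := fun y => ‖iteratedFDeriv ℝ r (fun z => κ • g z) y‖)
    (K := κ * (A * (1 + |s|) ^ r)) (by positivity) (fun _ => norm_nonneg _) (fun y => by
      rw [iteratedFDeriv_const_smul_apply' hgd.contDiffAt, norm_smul, Real.norm_of_nonneg hκ0.le,
        mul_assoc κ]
      exact mul_le_mul_of_nonneg_left (hbound s y) hκ0.le)
  refine hmain.trans ?_
  set P : ℝ := κ ^ (2 * σ) with hP
  have hP0 : 0 ≤ P := by positivity
  have hsabs : 1 + |s| ≤ (1 + |lam|) * (1 + T * P) := by
    rw [hs, abs_mul, abs_mul, abs_of_nonneg hT0, abs_of_nonneg hP0]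
    nlinarith [abs_nonneg lam, mul_nonneg hT0 hP0]
  have hadd : (1 + T * P) ^ r ≤ 2 ^ r * (1 + (T * P) ^ r) := by
    have h := add_pow_le (zero_le_one (α := ℝ)) (mul_nonneg hT0 hP0) r
    rw [one_pow] at h
    refine h.trans (mul_le_mul_of_nonneg_right ?_ (by positivity))
    exact pow_le_pow_right₀ one_le_two (Nat.sub_le r 1)
  have hκP : κ ^ (1 + 2 * σ * (r : ℝ)) = κ * P ^ r := by
    rw [Real.rpow_add hκ0, Real.rpow_one, Real.rpow_mul_natCast hκ0.le]
  calc κ * (A * (1 + |s|) ^ r) * J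
      ≤ κ * (A * ((1 + |lam|) ^ r * (2 ^ r * (1 + (T * P) ^ r)))) * (J + 1) := by
        gcongr
        · refine (pow_le_pow_left₀ (by positivity) hsabs r).trans ?_
          rw [mul_pow]
          gcongr
        · linarith
    _ = _ := by rw [hκP, mul_pow]; ring
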